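/- Let F be a field of characteristic p > 2, let α be a partition of n and β a one-box-shift of α with β_a = α_a − 1 and β_b = α_b + 1 for a < b, and let θ̂ : S^α → S^β be any FΣ_n-homomorphism, written θ̂ = Σ_T Λ_T θ̂_T over semistandard α-tableaux T of type β. Then for every semistandard α-set {T} of type β, (−1)^{|{T}|} Λ_{{T}} = (−1)^{|{T} ∩ {R}|} Λ_{{T} ∩ {R}}, where {R} is the removable set (note {T} ∩ {R} is again a semistandard α-set of type β). -/

import Mathlib

namespace CarterPayne

open Finset

/-- A partition of `n`, presented by its parts function; rows are indexed from `1`. -/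
structure Partition (n : ℕ) where
  parts : ℕ → ℕ
  parts_zero : parts 0 = 0
  antitone : ∀ ⦃i j : ℕ⦄, 0 < i → i ≤ j → parts j ≤ parts i
  finite_support : (Function.support parts).Finite
  sum_parts : ∑ᶠ i, parts i = n

variable {n : ℕ}

/-- The set of cells `(row, column)` (both 1-indexed) of the Young diagram of `μ`. -/
def Partition.cells (μ : Partition n) : Set (ℕ × ℕ) :=
  {c | 0 < c.1 ∧ 0 < c.2 ∧ c.2 ≤ μ.parts c.1}

/-- A tabloid for the composition `c` of `n`: an assignment of the `n` symbols to rows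
(rows indexed from 1), row `i` receiving exactly `c i` symbols. -/
def Tabloid (n : ℕ) (c : ℕ → ℕ) : Type :=
  {g : Fin n → ℕ // ∀ i, (Finset.univ.filter fun k => g k = i).card = c i}

/-- The permutation module `M^c` over `R`: the free `R`-module on the set of tabloids. -/
abbrev PermMod (R : Type*) [CommRing R] (n : ℕ) (c : ℕ → ℕ) := Tabloid n c →₀ R

/-- The action of a permutation of the symbols on tabloids. -/
def permTabloid (c : ℕ → ℕ) (π : Equiv.Perm (Fin n)) (f : Tabloid n c) : Tabloid n c :=
  ⟨fun k => f.1 (π.symm k), fun i => by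
    rw [← f.2 i]
    exact Finset.card_equiv π.symm fun a => by simp⟩

/-- The `R`-linear action of a permutation of the symbols on `M^c`. -/
noncomputable def permM (R : Type*) [CommRing R] (c : ℕ → ℕ) (π : Equiv.Perm (Fin n)) :
    PermMod R n c →ₗ[R] PermMod R n c :=
  Finsupp.lmapDomain R R (permTabloid c π)

/-- A bijective `μ`-tableau, presented by the placement map which sends each of the
`n` symbols to the cell of the Young diagram containing it. -/
structure Placement (μ : Partition n) where
  pos : Fin n → ℕ × ℕ
  mem : ∀ k, pos k ∈ μ.cells
  inj : Function.Injective pos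
  surj : ∀ c ∈ μ.cells, ∃ k, pos k = c

/-- The column stabilizer of a bijective tableau, as a set of permutations of the symbols. -/
def colStab {μ : Partition n} (T : Placement μ) : Finset (Equiv.Perm (Fin n)) :=
  Finset.univ.filter fun π => ∀ k, (T.pos (π k)).2 = (T.pos k).2

lemma rowFiber_card {μ : Partition n} (T : Placement μ) (i : ℕ) :
    (Finset.univ.filter fun k => (T.pos k).1 = i).card = μ.parts i := by
  classical
  have h : (Finset.univ.filter fun k => (T.pos k).1 = i).card
      = (Finset.Icc 1 (μ.parts i)).card := by
    apply Finset.card_bij (fun k _ => (T.pos k).2)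
    · intro a ha
      simp only [Finset.mem_filter, Finset.mem_univ, true_and] at ha
      obtain ⟨h1, h2, h3⟩ := T.mem a
      exact Finset.mem_Icc.mpr ⟨h2, ha ▸ h3⟩
    · intro a ha b hb hab
      simp only [Finset.mem_filter, Finset.mem_univ, true_and] at ha hb
      exact T.inj (Prod.ext (ha.trans hb.symm) hab)
    · intro j hj
      rw [Finset.mem_Icc] at hj
      have hi0 : 0 < i := by
        rcases Nat.eq_zero_or_pos i with h0 | h0
        · exfalso; rw [h0, μ.parts_zero] at hj; omega
        · exact h0
      obtain ⟨k, hk⟩ := T.surj (i, j) ⟨hi0, hj.1, hj.2⟩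
      exact ⟨k, by simp [hk], by simp [hk]⟩
  rw [h, Nat.card_Icc]
  omega

/-- The row tabloid `{tπ}` associated to the bijective tableau `tπ`. -/
def rowTabloid {μ : Partition n} (T : Placement μ) (π : Equiv.Perm (Fin n)) :
    Tabloid n μ.parts :=
  ⟨fun k => (T.pos (π k)).1, fun i => by
    rw [← rowFiber_card T i]
    exact Finset.card_equiv π fun a => by simp⟩

/-- The polytabloid `e_t` attached to a bijective tableau `t`. -/
noncomputable def polytabloid (R : Type*) [CommRing R] {μ : Partition n} (T : Placement μ) :
    PermMod R n μ.parts :=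
  ∑ π ∈ colStab T, ((Equiv.Perm.sign π : ℤ) : R) • Finsupp.single (rowTabloid T π) (1 : R)

/-- The Specht module `S^μ`, the span in `M^μ` of all polytabloids. -/
noncomputable def Specht (R : Type*) [CommRing R] (μ : Partition n) :
    Submodule R (PermMod R n μ.parts) :=
  Submodule.span R (Set.range fun T : Placement μ => polytabloid R T)

/-- `β` is obtained from the partition `α` of `n` by moving one box from
(the end of) row `a` to (the end of) row `b`; i.e. `β` is a one-box-shift of `α`. -/
structure OneBoxShift {n : ℕ} (α β : Partition n) (a b : ℕ) : Prop where
  a_pos : 0 < a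
  a_lt_b : a < b
  rem : α.parts (a + 1) < α.parts a
  add : α.parts b < α.parts (b - 1)
  at_a : β.parts a = α.parts a - 1
  at_b : β.parts b = α.parts b + 1
  elsewhere : ∀ i, i ≠ a → i ≠ b → β.parts i = α.parts i

/-- The space of `RΣ_n`-homomorphisms from `S^α` to `M^c` whose image lies in the
submodule `target` of `M^c`; an `R`-linear map is an `RΣ_n`-homomorphism when it
intertwines the permutation actions on source and target. -/
noncomputable def SpechtHom (R : Type*) [CommRing R] (α : Partition n) (c : ℕ → ℕ)
    (target : Submodule R (PermMod R n c)) :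
    Submodule R (↥(Specht R α) →ₗ[R] PermMod R n c) where
  carrier := {f | (∀ x, f x ∈ target) ∧
    ∀ (π : Equiv.Perm (Fin n)) (x y : ↥(Specht R α)),
      (x : PermMod R n α.parts) = permM R α.parts π (y : PermMod R n α.parts) →
      f x = permM R c π (f y)}
  add_mem' := by
    rintro f g ⟨hf1, hf2⟩ ⟨hg1, hg2⟩
    refine ⟨fun x => target.add_mem (hf1 x) (hg1 x), fun π x y hxy => ?_⟩
    simp only [LinearMap.add_apply, hf2 π x y hxy, hg2 π x y hxy, map_add]
  zero_mem' :=
    ⟨fun _ => target.zero_mem, fun π x y _ => by simp⟩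
  smul_mem' := by
    rintro r f ⟨hf1, hf2⟩
    refine ⟨fun x => target.smul_mem r (hf1 x), fun π x y hxy => ?_⟩
    simp only [LinearMap.smul_apply, hf2 π x y hxy, map_smul]

-- finiteness of the set of tabloids
lemma tabloid_finite (n : ℕ) (c : ℕ → ℕ) :
    {g : Fin n → ℕ | ∀ i, (Finset.univ.filter fun k => g k = i).card = c i}.Finite := by
  classical
  rcases Set.eq_empty_or_nonempty
      {g : Fin n → ℕ | ∀ i, (Finset.univ.filter fun k => g k = i).card = c i} with h | ⟨g₀, hg₀⟩
  · rw [h]; exact Set.finite_empty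
  · apply Set.Finite.subset (Set.Finite.pi fun _ : Fin n => Set.finite_range g₀)
    intro g hg
    simp only [Set.mem_pi, Set.mem_univ, forall_true_left]
    intro k
    have h1 : (Finset.univ.filter fun k' => g k' = g k).card = c (g k) := hg (g k)
    have h2 : (Finset.univ.filter fun k' => g₀ k' = g k).card = c (g k) := hg₀ (g k)
    have hp : 0 < c (g k) := by
      rw [← h1]
      exact Finset.card_pos.mpr ⟨k, by simp⟩
    rw [← h2] at hp
    obtain ⟨k', hk'⟩ := Finset.card_pos.mp hp
    simp only [Finset.mem_filter] at hk'
    exact ⟨k', hk'.2⟩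

noncomputable instance (c : ℕ → ℕ) : Fintype (Tabloid n c) :=
  (tabloid_finite n c).fintype

lemma cells_finite (μ : Partition n) : μ.cells.Finite := by
  apply Set.Finite.subset (μ.finite_support.prod (Set.finite_Icc 1 (μ.parts 1)))
  rintro ⟨i, j⟩ ⟨h1, h2, h3⟩
  refine Set.mem_prod.mpr ⟨?_, ?_⟩
  · simp only [Function.mem_support]
    intro h0
    rw [h0] at h3; omega
  · exact ⟨h2, le_trans h3 (μ.antitone Nat.one_pos h1)⟩

/-- The finset of cells of the Young diagram of `μ`. -/
noncomputable def cellFinset (μ : Partition n) : Finset (ℕ × ℕ) := (cells_finite μ).toFinset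

/-- An `α`-tableau (a filling of the diagram of `α` by natural numbers) has type `c`
if the entry `j` appears exactly `c j` times. -/
def IsTypeOf (α : Partition n) (c : ℕ → ℕ) (T : ℕ × ℕ → ℕ) : Prop :=
  ∀ j, ((cellFinset α).filter fun cc => T cc = j).card = c j

/-- A filling of the diagram of `α` is semistandard if its entries are nondecreasing
along rows and strictly increasing down columns. -/
def IsSemistandard (α : Partition n) (T : ℕ × ℕ → ℕ) : Prop :=
  (∀ i j j', (i, j) ∈ α.cells → (i, j') ∈ α.cells → j ≤ j' → T (i, j) ≤ T (i, j')) ∧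
  (∀ i i' j, (i, j) ∈ α.cells → (i', j) ∈ α.cells → i < i' → T (i, j) < T (i', j))

/-- Number of entries equal to `j` in row `i` of the `α`-tableau `T`. -/
def rowContent (α : Partition n) (T : ℕ × ℕ → ℕ) (i j : ℕ) : ℕ :=
  ((Finset.Icc 1 (α.parts i)).filter fun col => T (i, col) = j).card

open Classical in
/-- James' homomorphism `θ_T : M^α → M^c` attached to an `α`-tableau `T` of type `c`:
an `α`-tabloid `f` is sent to the sum of all `c`-tabloids `g` such that, for all `i`, `j`,
exactly `rowContent α T i j` symbols lie in row `i` of `f` and row `j` of `g`.  (This is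
the sum over the row-equivalence class of `T` of the corresponding tabloids.) -/
noncomputable def theta (R : Type*) [CommRing R] (α : Partition n) (c : ℕ → ℕ)
    (T : ℕ × ℕ → ℕ) : PermMod R n α.parts →ₗ[R] PermMod R n c :=
  Finsupp.lift (PermMod R n c) R (Tabloid n α.parts) fun f =>
    ∑ g ∈ Finset.univ.filter (fun g : Tabloid n c =>
        ∀ i j, (Finset.univ.filter fun k => f.1 k = i ∧ g.1 k = j).card = rowContent α T i j),
      Finsupp.single g (1 : R)

/-- The restriction `θ̂_T` of `θ_T` to the Specht module `S^α`. -/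
noncomputable def thetaHat (R : Type*) [CommRing R] (α : Partition n) (c : ℕ → ℕ)
    (T : ℕ × ℕ → ℕ) : ↥(Specht R α) →ₗ[R] PermMod R n c :=
  (theta R α c T).comp (Specht R α).subtype

/-- The composition `ν` obtained from `c` by replacing the rows `i`, `i+1` with rows of
sizes `c i + c (i+1) - r` and `r`. -/
def nuComp (c : ℕ → ℕ) (i r : ℕ) : ℕ → ℕ :=
  fun j => if j = i then c i + c (i + 1) - r else if j = i + 1 then r else c j

open Classical in
/-- James' homomorphism `ψ_{i,r} : M^c → M^ν`: a tabloid is sent to the sum of all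
tabloids obtained from it by changing all but `r` of the entries in row `i+1` to `i`. -/
noncomputable def psi (R : Type*) [CommRing R] (c : ℕ → ℕ) (i r : ℕ) :
    PermMod R n c →ₗ[R] PermMod R n (nuComp c i r) :=
  Finsupp.lift (PermMod R n (nuComp c i r)) R (Tabloid n c) fun f =>
    ∑ g ∈ Finset.univ.filter (fun g : Tabloid n (nuComp c i r) =>
        ∀ k, g.1 k = f.1 k ∨ (f.1 k = i + 1 ∧ g.1 k = i)),
      Finsupp.single g (1 : R)

/-- Normalized semistandard `α`-tableaux of type `c` (entries outside the diagram are `0`). -/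
def SSTSet (α : Partition n) (c : ℕ → ℕ) : Set (ℕ × ℕ → ℕ) :=
  {T | IsSemistandard α T ∧ IsTypeOf α c T ∧ ∀ cc, cc ∉ α.cells → T cc = 0}

lemma SSTSet_finite (α : Partition n) (c : ℕ → ℕ) (hc : (Function.support c).Finite) :
    (SSTSet α c).Finite := by
  classical
  have hinj : Set.InjOn (fun T (cc : ↥(cellFinset α)) => T cc.1) (SSTSet α c) := by
    intro T hT S hS h
    funext cc
    by_cases hcc : cc ∈ α.cells
    · have hmem : cc ∈ cellFinset α := (Set.Finite.mem_toFinset _).mpr hcc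
      exact congrFun h ⟨cc, hmem⟩
    · rw [hT.2.2 cc hcc, hS.2.2 cc hcc]
  have himage : ((fun T (cc : ↥(cellFinset α)) => T cc.1) '' SSTSet α c) ⊆
      Set.univ.pi (fun _ : ↥(cellFinset α) => insert 0 (Function.support c)) := by
    rintro _ ⟨T, hT, rfl⟩
    intro cc _
    have h1 := hT.2.1 (T cc.1)
    have h2 : cc.1 ∈ (cellFinset α).filter fun d => T d = T cc.1 :=
      Finset.mem_filter.mpr ⟨cc.2, rfl⟩
    have h3 : 0 < c (T cc.1) := h1 ▸ Finset.card_pos.mpr ⟨cc.1, h2⟩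
    exact Set.mem_insert_iff.mpr (Or.inr (by
      simp only [Function.mem_support]
      omega))
  exact Set.Finite.of_finite_image
    (Set.Finite.subset (Set.Finite.pi fun _ => hc.insert 0) himage) hinj

/-- The finset of all (normalized) semistandard `α`-tableaux of type `β`. -/
noncomputable def sstFinset (α β : Partition n) : Finset (ℕ × ℕ → ℕ) :=
  (SSTSet_finite α β.parts β.finite_support).toFinset

/-- `T̂(u)`, the entry at the end of row `u` of `T`. -/
def hatOf (α : Partition n) (T : ℕ × ℕ → ℕ) (u : ℕ) : ℕ := T (u, α.parts u)

/-- The semistandard `α`-set `{T}` of `T`: those rows `u ∈ {a, …, b-1}` with `T̂(u) ≠ u`. -/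
def Tset (α : Partition n) (a b : ℕ) (T : ℕ × ℕ → ℕ) : Finset ℕ :=
  (Finset.Icc a (b - 1)).filter fun u => hatOf α T u ≠ u

/-- The removable set `{R}`: those rows `i ∈ {a, …, b-1}` such that `(i, α_i)` is a
removable node of `[α]`. -/
def Rset (α : Partition n) (a b : ℕ) : Finset ℕ :=
  (Finset.Icc a (b - 1)).filter fun i => α.parts (i + 1) < α.parts i

/-- The hook lengths `h_i` in the `(α_b + 1)`-th column of `[α]` (with `h_i = 0` for `i ≥ b`):
`h_i = α_i - α_b + b - i - 1`. -/
def hook (α : Partition n) (b i : ℕ) : ℤ :=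
  if i < b then (α.parts i : ℤ) - (α.parts b : ℤ) + (b : ℤ) - (i : ℤ) - 1 else 0

/-- `T̂⁻¹(v)`: the row `u ∈ {a, …, b-1}` with `T̂(u) = v`. -/
noncomputable def invHat (α : Partition n) (a b : ℕ) (T : ℕ × ℕ → ℕ) (v : ℕ) : ℕ :=
  sInf {u | a ≤ u ∧ u ≤ b - 1 ∧ hatOf α T u = v}

/-- The smallest element of `X` greater than `u`, or `b` if there is none. -/
noncomputable def nextIn (X : Finset ℕ) (b u : ℕ) : ℕ := sInf ({v | v ∈ X ∧ u < v} ∪ {b})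

/-- The bijection `T̂ : {a,…,b-1} → {a+1,…,b}` determined by a semistandard set `X`:
`T̂` maps each `u ∈ X` to the next element of `X ∪ {b}` above it, and fixes `u ∉ X`. -/
noncomputable def hatOfSet (X : Finset ℕ) (b u : ℕ) : ℕ :=
  if u ∈ X then nextIn X b u else u

open Classical in
/-- The (normalized) semistandard `α`-tableau of type `β` whose semistandard set is `X`:
every cell of row `i` contains `i`, except that for `a ≤ i ≤ b-1` the last cell of row `i`
contains `T̂(i)` (where `T̂` is the bijection determined by `X`). -/
noncomputable def tableauOfSet (α : Partition n) (a b : ℕ) (X : Finset ℕ) : ℕ × ℕ → ℕ :=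
  fun cc =>
    if cc ∈ α.cells then
      (if a ≤ cc.1 ∧ cc.1 ≤ b - 1 ∧ cc.2 = α.parts cc.1 then hatOfSet X b cc.1 else cc.1)
    else 0

/-- `X` is a semistandard `α`-set of type `β` (for the one-box shift from row `a` to row `b`):
`a ∈ X ⊆ {a, …, b-1}`, and `u ∈ X` together with `α_{u+1} = α_u` forces `u+1 ∈ X`. -/
def IsSSSet (α : Partition n) (a b : ℕ) (X : Finset ℕ) : Prop :=
  a ∈ X ∧ (∀ u ∈ X, a ≤ u ∧ u ≤ b - 1) ∧
    ∀ u ∈ X, α.parts (u + 1) = α.parts u → u + 1 ∈ X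

/-- The coefficient `(-1)^{|T|} ∏_{u ∈ {R}\{T}} h_u` of `θ̂_T` in the Carter-Payne
homomorphism. -/
noncomputable def cpCoeff (α : Partition n) (a b : ℕ) (T : ℕ × ℕ → ℕ) : ℤ :=
  (-1) ^ (Tset α a b T).card * ∏ u ∈ Rset α a b \ Tset α a b T, hook α b u

/-! ### Auxiliary lemmas -/

/-- A tabloid from a function with the right fibre sizes. -/
def mkTab (c : ℕ → ℕ) (g : Fin n → ℕ)
    (h : ∀ i, (Finset.univ.filter fun k => g k = i).card = c i) : Tabloid n c := ⟨g, h⟩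

open Classical in
/-- The coefficient of `y` at the function `g`, being zero if `g` is not a tabloid. -/
noncomputable def coefAt (R : Type*) [CommRing R] (c : ℕ → ℕ) (g : Fin n → ℕ) :
    PermMod R n c →ₗ[R] R :=
  if h : ∀ i, (Finset.univ.filter fun k => g k = i).card = c i then
    Finsupp.lapply (mkTab c g h) else 0

open Classical in
lemma coefAt_single (R : Type*) [CommRing R] (c : ℕ → ℕ) (g : Fin n → ℕ) (f : Tabloid n c) :
    coefAt R c g (Finsupp.single f 1) = if f.1 = g then 1 else 0 := by
  unfold coefAt
  split_ifs with h h2 h2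
  · rw [Finsupp.lapply_apply, Finsupp.single_apply, if_pos (show f = mkTab c g h from Subtype.ext h2)]
  · rw [Finsupp.lapply_apply, Finsupp.single_apply, if_neg]
    intro h3; apply h2; rw [h3]; rfl
  · exact absurd (h2 ▸ f.2) h
  · rfl

open Classical in
lemma coefAt_polytabloid (R : Type*) [CommRing R] {μ : Partition n} (s : Placement μ)
    (g : Fin n → ℕ) :
    coefAt R μ.parts g (polytabloid R s) =
      ∑ π ∈ colStab s, if (∀ k, (s.pos (π k)).1 = g k) then ((Equiv.Perm.sign π : ℤ) : R) else 0 := by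
  unfold polytabloid
  rw [map_sum]
  refine Finset.sum_congr rfl fun π _ => ?_
  rw [map_smul, coefAt_single]
  have : ((rowTabloid s π).1 = g) ↔ (∀ k, (s.pos (π k)).1 = g k) := by
    rw [funext_iff]; rfl
  simp only [this, smul_eq_mul, mul_ite, mul_one, mul_zero]

/-- Elements of the Specht module are killed by the map changing one `u+1` into `u`. -/
lemma specht_kernel (R : Type*) [CommRing R] (μ : Partition n) (y : PermMod R n μ.parts)
    (hy : y ∈ Specht R μ) (u : ℕ) (hu : 0 < u) (h : Fin n → ℕ) :
    ∑ k ∈ Finset.univ.filter (fun k => h k = u),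
      coefAt R μ.parts (Function.update h k (u + 1)) y = 0 := by
  classical
  induction hy using Submodule.span_induction with
  | zero => simp
  | add x y _ _ hx hy => simp only [map_add, Finset.sum_add_distrib, hx, hy, add_zero]
  | smul r x _ hx => simp only [map_smul, ← Finset.smul_sum, hx, smul_zero]
  | mem x hx =>
    obtain ⟨s, rfl⟩ := hx
    simp only [coefAt_polytabloid]
    rw [← Finset.sum_product', ← Finset.sum_filter]
    have hup : ∀ q : Fin n, ∃ q', (s.pos q).1 = u + 1 → s.pos q' = (u, (s.pos q).2) := by
      intro q
      by_cases hq : (s.pos q).1 = u + 1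
      · obtain ⟨h1, h2, h3⟩ := s.mem q
        rw [hq] at h3
        obtain ⟨q', hq'⟩ := s.surj (u, (s.pos q).2)
          ⟨hu, h2, h3.trans (μ.antitone hu (Nat.le_succ u))⟩
        exact ⟨q', fun _ => hq'⟩
      · exact ⟨q, fun h => absurd h hq⟩
    choose up hup using hup
    have key : ∀ (k : Fin n) (π : Equiv.Perm (Fin n)), h k = u → π ∈ colStab s →
        (∀ k', (s.pos (π k')).1 = Function.update h k (u + 1) k') →
        s.pos (up (π k)) = (u, (s.pos (π k)).2) ∧ π.symm (up (π k)) ≠ k ∧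
          h (π.symm (up (π k))) = u := by
      intro k π hk hπ hc
      have h1 : (s.pos (π k)).1 = u + 1 := by rw [hc k]; simp
      have h2 := hup _ h1
      have h3 : π.symm (up (π k)) ≠ k := by
        intro h4
        have h5 : up (π k) = π k := by
          have h7 := congrArg π h4
          rwa [Equiv.apply_symm_apply] at h7
        rw [h5] at h2
        rw [h2] at h1
        simp at h1
      refine ⟨h2, h3, ?_⟩
      have h6 := hc (π.symm (up (π k)))
      rw [Function.update_of_ne h3, Equiv.apply_symm_apply, h2] at h6
      exact h6.symm
    apply Finset.sum_involution
      (fun (x : Fin n × Equiv.Perm (Fin n)) _ =>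
        (x.2.symm (up (x.2 x.1)), x.2 * Equiv.swap x.1 (x.2.symm (up (x.2 x.1)))))
    · rintro ⟨k, π⟩ hx
      simp only [Finset.mem_filter, Finset.mem_product, Finset.mem_univ, true_and] at hx
      obtain ⟨h2, h3, h4⟩ := key k π hx.1.1 hx.1.2 hx.2
      simp [Equiv.Perm.sign_mul, Equiv.Perm.sign_swap h3.symm]
    · rintro ⟨k, π⟩ hx _ heq
      simp only [Finset.mem_filter, Finset.mem_product, Finset.mem_univ, true_and] at hx
      obtain ⟨h2, h3, h4⟩ := key k π hx.1.1 hx.1.2 hx.2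
      exact h3 (congrArg Prod.fst heq)
    · rintro ⟨k, π⟩ hx
      simp only [Finset.mem_filter, Finset.mem_product, Finset.mem_univ, true_and] at hx ⊢
      obtain ⟨h2, h3, h4⟩ := key k π hx.1.1 hx.1.2 hx.2
      set k1 := π.symm (up (π k)) with hk1
      have hπk1 : π k1 = up (π k) := by simp [hk1]
      have hcol := hx.1.2
      simp only [colStab, Finset.mem_filter, Finset.mem_univ, true_and] at hcol
      have hck : (s.pos k1).2 = (s.pos k).2 := by
        rw [← hcol k1, hπk1, h2]
        exact hcol k
      refine ⟨⟨h4, ?_⟩, ?_⟩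
      · simp only [colStab, Finset.mem_filter, Finset.mem_univ, true_and]
        intro q
        rw [Equiv.Perm.mul_apply, hcol]
        by_cases hq : q = k
        · subst hq; rw [Equiv.swap_apply_left, hck]
        · by_cases hq1 : q = k1
          · subst hq1; rw [Equiv.swap_apply_right, hck]
          · rw [Equiv.swap_apply_of_ne_of_ne hq hq1]
      · intro q
        rw [Equiv.Perm.mul_apply]
        by_cases hq : q = k
        · subst hq
          rw [Equiv.swap_apply_left, Function.update_of_ne h3.symm, hπk1, h2, hx.1.1]
        · by_cases hq1 : q = k1
          · rw [hq1, Equiv.swap_apply_right, hx.2 k]; simp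
          · rw [Equiv.swap_apply_of_ne_of_ne hq hq1, hx.2 q, Function.update_of_ne hq,
              Function.update_of_ne hq1]
    · rintro ⟨k, π⟩ hx
      simp only [Prod.mk.injEq]
      have e1 : (π * Equiv.swap k (π.symm (up (π k)))) (π.symm (up (π k))) = π k := by
        rw [Equiv.Perm.mul_apply, Equiv.swap_apply_right]
      have e2 : (π * Equiv.swap k (π.symm (up (π k)))).symm (up (π k)) = k := by
        rw [Equiv.symm_apply_eq, Equiv.Perm.mul_apply, Equiv.swap_apply_left,
          Equiv.apply_symm_apply]
      rw [e1, e2]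
      refine ⟨rfl, ?_⟩
      rw [mul_assoc, Equiv.swap_comm, Equiv.swap_mul_self, mul_one]

/-- The content condition. -/
def ContentCond {α : Partition n} (t : Placement α) (T : ℕ × ℕ → ℕ) (g : Fin n → ℕ)
    (π : Equiv.Perm (Fin n)) : Prop :=
  ∀ i j, (Finset.univ.filter fun k => (t.pos (π k)).1 = i ∧ g k = j).card = rowContent α T i j

open Classical in
lemma coefAt_theta (R : Type*) [CommRing R] {α : Partition n} (c : ℕ → ℕ) (t : Placement α)
    (T : ℕ × ℕ → ℕ) (g : Fin n → ℕ)
    (hg : ∀ i, (Finset.univ.filter fun k => g k = i).card = c i) :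
    coefAt R c g (theta R α c T (polytabloid R t)) =
      ∑ π ∈ colStab t, if ContentCond t T g π then ((Equiv.Perm.sign π : ℤ) : R) else 0 := by
  unfold polytabloid
  rw [map_sum, map_sum]
  refine Finset.sum_congr rfl fun π _ => ?_
  rw [map_smul, map_smul]
  have hs : coefAt R c g (theta R α c T (Finsupp.single (rowTabloid t π) 1)) =
      if ContentCond t T g π then 1 else 0 := by
    unfold theta
    rw [Finsupp.lift_apply, Finsupp.sum_single_index (by simp), one_smul, map_sum]
    simp only [coefAt_single]
    by_cases hc : ContentCond t T g π
    · rw [if_pos hc]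
      refine (Finset.sum_eq_single (mkTab c g hg) ?_ ?_).trans ?_
      · intro f _ hf
        exact if_neg fun h => hf (Subtype.ext h)
      · intro h
        exact (h (Finset.mem_filter.mpr ⟨Finset.mem_univ _, hc⟩)).elim
      · exact if_pos rfl
    · rw [if_neg hc]
      refine Finset.sum_eq_zero fun f hf => if_neg fun h => hc ?_
      subst h
      exact (Finset.mem_filter.mp hf).2
  rw [hs]
  simp only [smul_eq_mul, mul_ite, mul_one, mul_zero]

open Classical in
lemma content_sum_zero (R : Type*) [CommRing R] {α : Partition n} (t : Placement α)
    (T : ℕ × ℕ → ℕ) (g : Fin n → ℕ) (k1 k2 : Fin n) (hne : k1 ≠ k2)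
    (hcol : (t.pos k1).2 = (t.pos k2).2) (hgg : g k1 = g k2) :
    ∑ π ∈ colStab t, (if ContentCond t T g π then ((Equiv.Perm.sign π : ℤ) : R) else 0) = 0 := by
  have hgs : ∀ q, g (Equiv.swap k1 k2 q) = g q := by
    intro q
    by_cases hq : q = k1
    · subst hq; rw [Equiv.swap_apply_left, hgg]
    · by_cases hq1 : q = k2
      · subst hq1; rw [Equiv.swap_apply_right, hgg]
      · rw [Equiv.swap_apply_of_ne_of_ne hq hq1]
  have hcs : ∀ q, (t.pos (Equiv.swap k1 k2 q)).2 = (t.pos q).2 := by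
    intro q
    by_cases hq : q = k1
    · subst hq; rw [Equiv.swap_apply_left, hcol]
    · by_cases hq1 : q = k2
      · subst hq1; rw [Equiv.swap_apply_right, hcol]
      · rw [Equiv.swap_apply_of_ne_of_ne hq hq1]
  have hcc : ∀ π, ContentCond t T g (π * Equiv.swap k1 k2) ↔ ContentCond t T g π := by
    intro π
    unfold ContentCond
    refine forall_congr' fun i => forall_congr' fun j => ?_
    have h1 : (Finset.univ.filter fun k =>
          (t.pos ((π * Equiv.swap k1 k2) k)).1 = i ∧ g k = j).card =
        (Finset.univ.filter fun k => (t.pos (π k)).1 = i ∧ g k = j).card := by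
      apply Finset.card_equiv (Equiv.swap k1 k2)
      intro q
      rw [Finset.mem_filter, Finset.mem_filter, hgs, Equiv.Perm.mul_apply]
      simp only [Finset.mem_univ, true_and]
    rw [h1]
  apply Finset.sum_involution (fun π _ => π * Equiv.swap k1 k2)
  · intro π _
    simp only [hcc]
    split_ifs <;> simp [Equiv.Perm.sign_mul, Equiv.Perm.sign_swap hne]
  · intro π _ _ h
    have : Equiv.swap k1 k2 = 1 := by simpa using h
    exact hne (Equiv.swap_eq_one_iff.mp this)
  · intro π hπ
    simp only [colStab, Finset.mem_filter, Finset.mem_univ, true_and] at hπ ⊢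
    intro q
    rw [Equiv.Perm.mul_apply, hπ, hcs]
  · intro π _
    rw [mul_assoc, Equiv.swap_mul_self, mul_one]

lemma mem_cellFinset (α : Partition n) (c : ℕ × ℕ) : c ∈ cellFinset α ↔ c ∈ α.cells := by
  unfold cellFinset
  exact Set.Finite.mem_toFinset _

lemma card_row (α : Partition n) (i : ℕ) :
    ((cellFinset α).filter fun c => c.1 = i).card = α.parts i := by
  classical
  have h : ((cellFinset α).filter fun c => c.1 = i).card = (Finset.Icc 1 (α.parts i)).card := by
    apply Finset.card_bij (fun c _ => c.2)
    · intro c hc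
      rw [Finset.mem_filter, mem_cellFinset] at hc
      obtain ⟨⟨h1, h2, h3⟩, h4⟩ := hc
      exact Finset.mem_Icc.mpr ⟨h2, h4 ▸ h3⟩
    · intro c hc d hd hcd
      rw [Finset.mem_filter] at hc hd
      exact Prod.ext (hc.2.trans hd.2.symm) hcd
    · intro j hj
      rw [Finset.mem_Icc] at hj
      have hi0 : 0 < i := by
        rcases Nat.eq_zero_or_pos i with h0 | h0
        · exfalso; rw [h0, α.parts_zero] at hj; omega
        · exact h0
      refine ⟨(i, j), ?_, rfl⟩
      rw [Finset.mem_filter, mem_cellFinset]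
      exact ⟨⟨hi0, hj.1, hj.2⟩, rfl⟩
  rw [h, Nat.card_Icc]
  omega

lemma card_cellFinset (α : Partition n) : (cellFinset α).card = n := by
  classical
  have h1 : ∑ᶠ i, α.parts i = ∑ i ∈ α.finite_support.toFinset, α.parts i :=
    finsum_eq_sum α.parts α.finite_support
  rw [α.sum_parts] at h1
  conv_rhs => rw [h1]
  rw [Finset.card_eq_sum_card_fiberwise (f := Prod.fst) (t := α.finite_support.toFinset)]
  · exact Finset.sum_congr rfl fun i _ => card_row α i
  · intro c hc
    have hc' := (mem_cellFinset α c).mp hc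
    obtain ⟨h1, h2, h3⟩ := hc'
    simp only [Set.Finite.coe_toFinset, Function.mem_support]
    omega

lemma exists_placement (α : Partition n) : Nonempty (Placement α) := by
  let e := ((cellFinset α).equivFinOfCardEq (card_cellFinset α)).symm
  refine ⟨⟨fun k => (e k).1, fun k => (mem_cellFinset α _).mp (e k).2,
    fun x y h => e.injective (Subtype.ext h), fun c hc => ?_⟩⟩
  exact ⟨e.symm ⟨c, (mem_cellFinset α c).mpr hc⟩, by simp⟩

/-! ### The map `hatOfSet` -/

lemma nextIn_spec (X : Finset ℕ) (b u : ℕ) (hub : u < b) (_hX : ∀ x ∈ X, x ≤ b - 1) :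
    (nextIn X b u ∈ X ∨ nextIn X b u = b) ∧ u < nextIn X b u ∧ nextIn X b u ≤ b ∧
      ∀ x ∈ X, u < x → nextIn X b u ≤ x := by
  have hne : ({v | v ∈ X ∧ u < v} ∪ {b} : Set ℕ).Nonempty := ⟨b, Or.inr rfl⟩
  have h1 : nextIn X b u ∈ ({v | v ∈ X ∧ u < v} ∪ {b} : Set ℕ) := Nat.sInf_mem hne
  have h2 : ∀ x ∈ ({v | v ∈ X ∧ u < v} ∪ {b} : Set ℕ), nextIn X b u ≤ x :=
    fun x hx => Nat.sInf_le hx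
  refine ⟨?_, ?_, h2 b (Or.inr rfl), fun x hx hux => h2 x (Or.inl ⟨hx, hux⟩)⟩
  · rcases h1 with h | h
    · exact Or.inl h.1
    · exact Or.inr h
  · rcases h1 with h | h
    · exact h.2
    · have h3 : nextIn X b u = b := h
      omega

lemma nextIn_eq (X : Finset ℕ) (b u w : ℕ) (hub : u < b) (hX : ∀ x ∈ X, x ≤ b - 1)
    (hw : w ∈ X ∨ w = b) (huw : u < w) (hmin : ∀ x ∈ X, u < x → w ≤ x) :
    nextIn X b u = w := by
  obtain ⟨h1, h2, h3, h4⟩ := nextIn_spec X b u hub hX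
  have hwb : w ≤ b := by
    rcases hw with h | h
    · have := hX w h; omega
    · omega
  apply le_antisymm
  · rcases hw with h | h
    · exact h4 w h huw
    · omega
  · rcases h1 with h | h
    · exact hmin _ h h2
    · omega

lemma hatOfSet_ge (X : Finset ℕ) (b u : ℕ) (hub : u < b) (hX : ∀ x ∈ X, x ≤ b - 1) :
    u ≤ hatOfSet X b u := by
  unfold hatOfSet
  split_ifs
  · exact (nextIn_spec X b u hub hX).2.1.le
  · exact le_rfl

lemma hatOfSet_inj (X : Finset ℕ) (b u v : ℕ) (hub : u < b) (hvb : v < b)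
    (hX : ∀ x ∈ X, x ≤ b - 1) (h : hatOfSet X b u = hatOfSet X b v) : u = v := by
  have hu := nextIn_spec X b u hub hX
  have hv := nextIn_spec X b v hvb hX
  unfold hatOfSet at h
  split_ifs at h with h1 h2 h2
  · rcases lt_trichotomy u v with h3 | h3 | h3
    · have := hu.2.2.2 v h2 h3; omega
    · exact h3
    · have := hv.2.2.2 u h1 h3; omega
  · exfalso
    rcases hu.1 with h3 | h3
    · rw [h] at h3; exact h2 h3
    · omega
  · exfalso
    rcases hv.1 with h3 | h3
    · rw [← h] at h3; exact h1 h3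
    · omega
  · exact h

lemma hatOfSet_image (X : Finset ℕ) (a b : ℕ) (haX : a ∈ X) (hab : a < b)
    (hX : ∀ x ∈ X, a ≤ x ∧ x ≤ b - 1) :
    (Finset.Icc a (b - 1)).image (hatOfSet X b) = Finset.Icc (a + 1) b := by
  have hX' : ∀ x ∈ X, x ≤ b - 1 := fun x hx => (hX x hx).2
  apply Finset.eq_of_subset_of_card_le
  · intro w hw
    obtain ⟨u, hu, rfl⟩ := Finset.mem_image.mp hw
    rw [Finset.mem_Icc] at hu ⊢
    have hs := nextIn_spec X b u (by omega) hX'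
    unfold hatOfSet
    split_ifs with h1
    · omega
    · have : u ≠ a := fun h => h1 (h ▸ haX)
      omega
  · rw [Finset.card_image_of_injOn]
    · simp only [Nat.card_Icc]; omega
    · intro u hu v hv h
      simp only [Finset.coe_Icc, Set.mem_Icc] at hu hv
      exact hatOfSet_inj X b u v (by omega) (by omega) hX' h

lemma tableau_plain (α : Partition n) (a b : ℕ) (X : Finset ℕ) (i j : ℕ) (hc : (i, j) ∈ α.cells)
    (hp : ¬ (a ≤ i ∧ i ≤ b - 1 ∧ j = α.parts i)) : tableauOfSet α a b X (i, j) = i := by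
  unfold tableauOfSet
  rw [if_pos hc, if_neg hp]

lemma tableau_end (α : Partition n) (a b : ℕ) (X : Finset ℕ) (i j : ℕ) (hc : (i, j) ∈ α.cells)
    (hp : a ≤ i ∧ i ≤ b - 1 ∧ j = α.parts i) : tableauOfSet α a b X (i, j) = hatOfSet X b i := by
  unfold tableauOfSet
  rw [if_pos hc, if_pos hp]

lemma end_mem {α β : Partition n} {a b : ℕ} (hs : OneBoxShift α β a b) (i : ℕ) (h1 : a ≤ i)
    (h2 : i ≤ b - 1) : (i, α.parts i) ∈ α.cells := by
  have := hs.a_pos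
  have := hs.a_lt_b
  have h3 := hs.add
  have := α.antitone (by omega : 0 < i) h2
  exact ⟨by simp only; omega, by simp only; omega, le_rfl⟩

lemma tableau_ge {α β : Partition n} {a b : ℕ} (hs : OneBoxShift α β a b) (X : Finset ℕ)
    (hX : IsSSSet α a b X) (i j : ℕ) (hc : (i, j) ∈ α.cells) :
    i ≤ tableauOfSet α a b X (i, j) := by
  have := hs.a_lt_b
  by_cases hp : a ≤ i ∧ i ≤ b - 1 ∧ j = α.parts i
  · rw [tableau_end α a b X i j hc hp]
    exact hatOfSet_ge X b i (by omega) fun x hx => (hX.2.1 x hx).2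
  · rw [tableau_plain α a b X i j hc hp]

lemma tableau_semistandard {α β : Partition n} {a b : ℕ} (hs : OneBoxShift α β a b) (X : Finset ℕ)
    (hX : IsSSSet α a b X) : IsSemistandard α (tableauOfSet α a b X) := by
  have hab := hs.a_lt_b
  have hX' : ∀ x ∈ X, x ≤ b - 1 := fun x hx => (hX.2.1 x hx).2
  constructor
  · intro i j j' hc hc' hjj
    by_cases hp : a ≤ i ∧ i ≤ b - 1 ∧ j = α.parts i
    · have h3 : j' ≤ α.parts i := hc'.2.2
      have : j = j' := by omega
      rw [this]
    · rw [tableau_plain α a b X i j hc hp]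
      exact tableau_ge hs X hX i j' hc'
  · intro i i' j hc hc' hii
    have hge := tableau_ge hs X hX i' j hc'
    by_cases hp : a ≤ i ∧ i ≤ b - 1 ∧ j = α.parts i
    · rw [tableau_end α a b X i j hc hp]
      have h0 : 0 < i := hc.1
      have h1 : j ≤ α.parts i' := hc'.2.2
      have h2 := α.antitone (by omega : 0 < i + 1) (by omega : i + 1 ≤ i')
      have h3 := α.antitone h0 (by omega : i ≤ i + 1)
      have h4 : α.parts (i + 1) = α.parts i := by omega
      by_cases hi : i ∈ X
      · have h5 := hX.2.2 i hi h4
        have h6 : hatOfSet X b i = i + 1 := by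
          unfold hatOfSet
          rw [if_pos hi]
          exact nextIn_eq X b i (i + 1) (by omega) hX' (Or.inl h5) (by omega)
            (fun x _ hx => by omega)
        rw [h6]
        rcases Nat.lt_or_ge (i + 1) i' with h7 | h7
        · omega
        · have h8 : i' = i + 1 := by omega
          subst h8
          have h9 := hX.2.1 _ h5
          rw [tableau_end α a b X (i + 1) j hc' ⟨h9.1, h9.2, by omega⟩]
          unfold hatOfSet
          rw [if_pos h5]
          exact (nextIn_spec X b (i + 1) (by omega) hX').2.1
      · unfold hatOfSet
        rw [if_neg hi]
        omega
    · rw [tableau_plain α a b X i j hc hp]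
      omega

lemma tableau_type {α β : Partition n} {a b : ℕ} (hs : OneBoxShift α β a b) (X : Finset ℕ)
    (hX : IsSSSet α a b X) : IsTypeOf α β.parts (tableauOfSet α a b X) := by
  classical
  have hab := hs.a_lt_b
  have hX' : ∀ x ∈ X, x ≤ b - 1 := fun x hx => (hX.2.1 x hx).2
  intro j
  let P : ℕ × ℕ → Prop := fun c => a ≤ c.1 ∧ c.1 ≤ b - 1 ∧ c.2 = α.parts c.1
  have split : ∀ (Q : ℕ × ℕ → Prop) [DecidablePred Q], ((cellFinset α).filter Q).card =
      ((cellFinset α).filter fun c => Q c ∧ P c).card +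
      ((cellFinset α).filter fun c => Q c ∧ ¬ P c).card := by
    intro Q _
    rw [← Finset.card_filter_add_card_filter_not (s := (cellFinset α).filter Q) P,
      Finset.filter_filter, Finset.filter_filter]
  have endc : ∀ f : ℕ → ℕ, ((cellFinset α).filter fun c => f c.1 = j ∧ P c).card =
      ((Finset.Icc a (b - 1)).filter fun i => f i = j).card := by
    intro f
    apply Finset.card_bij (fun c _ => c.1)
    · intro c hc
      rw [Finset.mem_filter] at hc
      rw [Finset.mem_filter, Finset.mem_Icc]
      exact ⟨⟨hc.2.2.1, hc.2.2.2.1⟩, hc.2.1⟩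
    · intro c hc d hd hcd
      rw [Finset.mem_filter] at hc hd
      refine Prod.ext hcd ?_
      rw [hc.2.2.2.2, hd.2.2.2.2, hcd]
    · intro i hi
      rw [Finset.mem_filter, Finset.mem_Icc] at hi
      refine ⟨(i, α.parts i), ?_, rfl⟩
      rw [Finset.mem_filter, mem_cellFinset]
      exact ⟨end_mem hs i hi.1.1 hi.1.2, hi.2, hi.1.1, hi.1.2, rfl⟩
  have e1 : ((cellFinset α).filter fun c => tableauOfSet α a b X c = j ∧ P c) =
      ((cellFinset α).filter fun c => hatOfSet X b c.1 = j ∧ P c) := by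
    apply Finset.filter_congr
    rintro ⟨i, k⟩ hc
    rw [mem_cellFinset] at hc
    refine and_congr_left fun hp => ?_
    rw [tableau_end α a b X i k hc hp]
  have e2 : ((cellFinset α).filter fun c => tableauOfSet α a b X c = j ∧ ¬ P c) =
      ((cellFinset α).filter fun c => c.1 = j ∧ ¬ P c) := by
    apply Finset.filter_congr
    rintro ⟨i, k⟩ hc
    rw [mem_cellFinset] at hc
    refine and_congr_left fun hp => ?_
    rw [tableau_plain α a b X i k hc hp]
  have s1 := split fun c => tableauOfSet α a b X c = j
  have s2 := split fun c => c.1 = j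
  rw [e1, e2, endc (hatOfSet X b)] at s1
  rw [endc fun i => i, card_row] at s2
  have c1 : ((Finset.Icc a (b - 1)).filter fun i => hatOfSet X b i = j).card =
      if j ∈ Finset.Icc (a + 1) b then 1 else 0 := by
    rw [← hatOfSet_image X a b hX.1 hab hX.2.1]
    split_ifs with h
    · obtain ⟨i, hi, hij⟩ := Finset.mem_image.mp h
      rw [Finset.card_eq_one]
      refine ⟨i, ?_⟩
      ext k
      rw [Finset.mem_filter, Finset.mem_singleton]
      constructor
      · rintro ⟨hk, hkj⟩
        rw [Finset.mem_Icc] at hk hi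
        exact hatOfSet_inj X b k i (by omega) (by omega) hX' (hkj.trans hij.symm)
      · rintro rfl
        exact ⟨hi, hij⟩
    · rw [Finset.card_eq_zero, Finset.filter_eq_empty_iff]
      intro k hk hkj
      exact h (Finset.mem_image.mpr ⟨k, hk, hkj⟩)
  have c2 : ((Finset.Icc a (b - 1)).filter fun i => i = j).card =
      if j ∈ Finset.Icc a (b - 1) then 1 else 0 := by
    rw [Finset.filter_eq']
    split_ifs <;> simp
  rw [c1] at s1
  rw [c2] at s2
  rw [s1]
  simp only [Finset.mem_Icc] at s2 ⊢
  have ha := hs.at_a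
  have hb := hs.at_b
  have hrem := hs.rem
  by_cases hja : j = a
  · subst hja
    rw [if_pos (by omega)] at s2
    rw [if_neg (by omega)]
    omega
  · by_cases hjb : j = b
    · subst hjb
      rw [if_neg (by omega)] at s2
      rw [if_pos (by omega)]
      omega
    · rw [hs.elsewhere j hja hjb]
      by_cases hj : a ≤ j ∧ j ≤ b - 1
      · rw [if_pos hj] at s2
        rw [if_pos (by omega)]
        omega
      · rw [if_neg hj] at s2
        rw [if_neg (by omega)]
        omega

lemma tableau_mem {α β : Partition n} {a b : ℕ} (hs : OneBoxShift α β a b) (X : Finset ℕ)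
    (hX : IsSSSet α a b X) : tableauOfSet α a b X ∈ sstFinset α β := by
  unfold sstFinset
  rw [Set.Finite.mem_toFinset]
  refine ⟨tableau_semistandard hs X hX, tableau_type hs X hX, fun c hc => ?_⟩
  unfold tableauOfSet
  rw [if_neg hc]

lemma content_id {α : Partition n} (t : Placement α) (T : ℕ × ℕ → ℕ) :
    ContentCond t T (fun k => T (t.pos k)) 1 := by
  classical
  intro i j
  unfold rowContent
  apply Finset.card_bij (fun k _ => (t.pos k).2)
  · intro k hk
    replace hk := (Finset.mem_filter.mp hk).2
    rw [Equiv.Perm.one_apply] at hk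
    obtain ⟨h1, h2, h3⟩ := t.mem k
    rw [Finset.mem_filter, Finset.mem_Icc]
    refine ⟨⟨h2, hk.1 ▸ h3⟩, ?_⟩
    rw [← hk.2, ← hk.1]
  · intro k hk l hl hkl
    replace hk := (Finset.mem_filter.mp hk).2
    replace hl := (Finset.mem_filter.mp hl).2
    rw [Equiv.Perm.one_apply] at hk hl
    exact t.inj (Prod.ext (hk.1.trans hl.1.symm) hkl)
  · intro c hc
    rw [Finset.mem_filter, Finset.mem_Icc] at hc
    have hi0 : 0 < i := by
      rcases Nat.eq_zero_or_pos i with h0 | h0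
      · exfalso; rw [h0, α.parts_zero] at hc; omega
      · exact h0
    obtain ⟨k, hk⟩ := t.surj (i, c) ⟨hi0, hc.1.1, hc.1.2⟩
    refine ⟨k, Finset.mem_filter.mpr ⟨Finset.mem_univ _, ?_, ?_⟩, by simp [hk]⟩
    · rw [Equiv.Perm.one_apply, hk]
    · simp only [hk, hc.2]

lemma sst_ge {α β : Partition n} (T : ℕ × ℕ → ℕ) (hT : T ∈ SSTSet α β.parts) :
    ∀ i j, (i, j) ∈ α.cells → i ≤ T (i, j) := by
  obtain ⟨h1, h2, _⟩ := hT
  intro i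
  induction i with
  | zero => intro j _; exact Nat.zero_le _
  | succ i ih =>
    intro j hc
    rcases Nat.eq_zero_or_pos i with h0 | h0
    · subst h0
      rcases Nat.eq_zero_or_pos (T (0 + 1, j)) with h3 | h3
      · exfalso
        have h4 := h2 0
        rw [β.parts_zero, Finset.card_eq_zero] at h4
        have h5 : (0 + 1, j) ∈ (cellFinset α).filter fun cc => T cc = 0 :=
          Finset.mem_filter.mpr ⟨(mem_cellFinset α _).mpr hc, h3⟩
        rw [h4] at h5
        simp at h5
      · omega
    · have hc' : (i, j) ∈ α.cells :=
        ⟨h0, hc.2.1, le_trans hc.2.2 (α.antitone h0 (Nat.le_succ i))⟩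
      have h3 := ih j hc'
      have h4 := h1.2 i (i + 1) j hc' hc (Nat.lt_succ_self i)
      omega

/-- The plain cells of a column lie above the non-plain ones. -/
lemma nonplain_down {α β : Partition n} {a b : ℕ} (hs : OneBoxShift α β a b) (i r c : ℕ)
    (hir : i ≤ r) (hc : (r, c) ∈ α.cells) (hp : a ≤ i ∧ i ≤ b - 1 ∧ c = α.parts i) :
    a ≤ r ∧ r ≤ b - 1 ∧ c = α.parts r := by
  have h0 := hs.a_pos
  have hab := hs.a_lt_b
  have hadd := hs.add
  have h1 : c ≤ α.parts r := hc.2.2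
  have h2 := α.antitone (by omega : 0 < i) hir
  have h3 := α.antitone (by omega : 0 < i) hp.2.1
  refine ⟨by omega, ?_, by omega⟩
  by_contra hr
  have h4 := α.antitone (by omega : 0 < b) (by omega : b ≤ r)
  omega

/-- The unitriangularity statement: among semistandard tableaux `T` only `T_X` contributes
to the coefficient at `T_X`, through the identity permutation. -/
lemma content_unique {α β : Partition n} {a b : ℕ} (hs : OneBoxShift α β a b) (X : Finset ℕ)
    (hX : IsSSSet α a b X) (t : Placement α) (T : ℕ × ℕ → ℕ) (hT : T ∈ SSTSet α β.parts)
    (π : Equiv.Perm (Fin n)) (hπ : π ∈ colStab t)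
    (hc : ContentCond t T (fun k => tableauOfSet α a b X (t.pos k)) π) :
    π = 1 ∧ T = tableauOfSet α a b X := by
  classical
  set G := tableauOfSet α a b X with hG
  have hGss : IsSemistandard α G := tableau_semistandard hs X hX
  simp only [colStab, Finset.mem_filter, Finset.mem_univ, true_and] at hπ
  have hTge := sst_ge T hT
  -- content in both directions
  have toT : ∀ k, ∃ c, ((t.pos (π k)).1, c) ∈ α.cells ∧ T ((t.pos (π k)).1, c) = G (t.pos k) := by
    intro k
    have h1 := hc (t.pos (π k)).1 (G (t.pos k))
    have h2 : 0 < rowContent α T (t.pos (π k)).1 (G (t.pos k)) := by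
      rw [← h1]
      exact Finset.card_pos.mpr ⟨k, by simp⟩
    obtain ⟨c, hc⟩ := Finset.card_pos.mp h2
    rw [Finset.mem_filter, Finset.mem_Icc] at hc
    exact ⟨c, ⟨(t.mem (π k)).1, hc.1.1, hc.1.2⟩, hc.2⟩
  have fromT : ∀ i c, (i, c) ∈ α.cells → ∃ k, (t.pos (π k)).1 = i ∧ G (t.pos k) = T (i, c) := by
    intro i c hic
    have h1 := hc i (T (i, c))
    have h2 : 0 < rowContent α T i (T (i, c)) := by
      apply Finset.card_pos.mpr
      exact ⟨c, Finset.mem_filter.mpr ⟨Finset.mem_Icc.mpr ⟨hic.2.1, hic.2.2⟩, rfl⟩⟩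
    rw [← h1] at h2
    obtain ⟨k, hk⟩ := Finset.card_pos.mp h2
    simp only [Finset.mem_filter, Finset.mem_univ, true_and] at hk
    exact ⟨k, hk⟩
  have rowle : ∀ k, (t.pos (π k)).1 ≤ G (t.pos k) := by
    intro k
    obtain ⟨c, h1, h2⟩ := toT k
    rw [← h2]
    exact hTge _ _ h1
  have posext : ∀ k l, (t.pos k).1 = (t.pos l).1 → (t.pos k).2 = (t.pos l).2 → k = l :=
    fun k l h1 h2 => t.inj (Prod.ext h1 h2)
  let plain : Fin n → Prop := fun k =>
    ¬ (a ≤ (t.pos k).1 ∧ (t.pos k).1 ≤ b - 1 ∧ (t.pos k).2 = α.parts (t.pos k).1)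
  have hGplain : ∀ k, plain k → G (t.pos k) = (t.pos k).1 := fun k hk =>
    tableau_plain α a b X (t.pos k).1 (t.pos k).2 (t.mem k) hk
  -- an inductive principle: if everything above `k` is fixed then `π k` is not above `k`
  have notup : ∀ k, (∀ l, (t.pos l).2 = (t.pos k).2 → (t.pos l).1 < (t.pos k).1 → π l = l) →
      (t.pos k).1 ≤ (t.pos (π k)).1 := by
    intro k hk
    by_contra hlt
    have h1 := hk (π k) (hπ k) (by omega)
    have h2 := π.injective h1
    rw [h2] at hlt
    exact hlt le_rfl
  have plainfix : ∀ r k, (t.pos k).1 = r → plain k → π k = k := by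
    intro r
    induction r using Nat.strong_induction_on with
    | _ r ih =>
      intro k hkr hk
      apply posext _ _ _ (hπ k)
      apply le_antisymm
      · rw [← hGplain k hk]; exact rowle k
      · apply notup
        intro l hl1 hl2
        refine ih (t.pos l).1 (by omega) l rfl ?_
        intro hp
        apply hk
        rw [hl1] at hp
        exact nonplain_down hs (t.pos l).1 (t.pos k).1 (t.pos k).2 hl2.le (t.mem k) hp
  -- everything is fixed
  have allfix : ∀ r k, (t.pos k).1 = r → π k = k := by
    intro r
    induction r using Nat.strong_induction_on with
    | _ r ih =>
      intro k hkr
      by_cases hk : plain k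
      · exact plainfix r k hkr hk
      have hk' : a ≤ (t.pos k).1 ∧ (t.pos k).1 ≤ b - 1 ∧
        (t.pos k).2 = α.parts (t.pos k).1 := not_not.mp hk
      by_contra hne
      have habove : ∀ l, (t.pos l).2 = (t.pos k).2 → (t.pos l).1 < (t.pos k).1 → π l = l :=
        fun l _ h2 => ih (t.pos l).1 (by omega) l rfl
      have h1 := notup k habove
      have h2 : (t.pos k).1 < (t.pos (π k)).1 := by
        refine lt_of_le_of_ne h1 fun h => hne ?_
        exact posext _ _ h.symm (hπ k)
      obtain ⟨k', hk'e⟩ := π.surjective k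
      have hcol' : (t.pos k').2 = (t.pos k).2 := by rw [← hk'e, hπ]
      have h3 : (t.pos k).1 < (t.pos k').1 := by
        by_contra h4
        rcases Nat.lt_or_ge (t.pos k').1 (t.pos k).1 with h5 | h5
        · have h6 := habove k' hcol' h5
          rw [hk'e] at h6
          rw [← h6] at h5
          exact lt_irrefl _ h5
        · have h6 : k' = k := posext _ _ (by omega) hcol'
          rw [h6] at hk'e
          exact hne hk'e
      have hs1 := nonplain_down hs (t.pos k).1 (t.pos (π k)).1 (t.pos k).2 h2.le
        (by rw [← hπ k]; exact t.mem (π k)) hk'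
      have hcell : ((t.pos k).1, (t.pos k).2) ∈ α.cells := t.mem k
      have hcell2 : ((t.pos (π k)).1, (t.pos k).2) ∈ α.cells := by
        rw [← hπ k]; exact t.mem (π k)
      have hcell3 : ((t.pos k').1, (t.pos k).2) ∈ α.cells := by
        rw [← hcol']; exact t.mem k'
      have hTlt := hT.1.2 _ _ _ hcell hcell2 h2
      have hGlt := hGss.2 _ _ _ hcell hcell3 h3
      have hGk : G (t.pos k) = G ((t.pos k).1, (t.pos k).2) := rfl
      have hGk' : G (t.pos k') = G ((t.pos k').1, (t.pos k).2) := by rw [← hcol']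
      obtain ⟨c, hc1, hc2⟩ := toT k'
      rw [hk'e] at hc1 hc2
      have hle : T ((t.pos k).1, c) ≤ T ((t.pos k).1, (t.pos k).2) := by
        apply hT.1.1 _ _ _ hc1 hcell
        rw [hk'.2.2]
        exact hc1.2.2
      obtain ⟨q, hq1, hq2⟩ := fromT _ _ hcell2
      have hqle : G (t.pos q) ≤ G (t.pos k) := by
        by_cases hq : plain q
        · have hq3 := plainfix _ q rfl hq
          rw [hGplain q hq]
          rw [hq3] at hq1
          rw [hq1]
          exact rowle k
        · have hqn : ¬ plain (π q) := by
            intro h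
            have h5 := π.injective (plainfix _ (π q) rfl h)
            rw [h5] at h
            exact hq h
          have hqn' := not_not.mp hqn
          have h5 : π q = π k := by
            apply posext _ _ hq1
            rw [hqn'.2.2, hq1, ← hs1.2.2, hπ]
          rw [π.injective h5]
      omega
  have hπ1 : π = 1 := by
    ext k
    rw [allfix _ k rfl, Equiv.Perm.one_apply]
  refine ⟨hπ1, ?_⟩
  subst hπ1
  simp only [Equiv.Perm.one_apply] at toT fromT
  funext ⟨i, c⟩
  by_cases hic : (i, c) ∈ α.cells
  swap
  · rw [hT.2.2 _ hic, hG]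
    unfold tableauOfSet
    rw [if_neg hic]
  -- values in row `i`
  have val : ∀ c, (i, c) ∈ α.cells → T (i, c) = i ∨
      ((a ≤ i ∧ i ≤ b - 1) ∧ T (i, c) = G (i, α.parts i)) := by
    intro c hic
    obtain ⟨k, hk1, hk2⟩ := fromT i c hic
    by_cases hk : plain k
    · left; rw [← hk2, hGplain k hk, hk1]
    · right
      have hk' := not_not.mp hk
      rw [hk1] at hk'
      refine ⟨⟨hk'.1, hk'.2.1⟩, ?_⟩
      rw [← hk2, ← hk'.2.2, ← hk1]
  by_cases hrow : a ≤ i ∧ i ≤ b - 1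
  swap
  · rw [hG, tableau_plain α a b X i c hic (fun h => hrow ⟨h.1, h.2.1⟩)]
    rcases val c hic with h | h
    · exact h
    · exact absurd h.1 hrow
  have hend := end_mem hs i hrow.1 hrow.2
  have hGge := tableau_ge hs X hX i _ hend
  rw [← hG] at hGge
  have hTend : T (i, α.parts i) = G (i, α.parts i) := by
    obtain ⟨k, hk⟩ := t.surj _ hend
    obtain ⟨c', h1, h2⟩ := toT k
    rw [hk] at h1 h2
    have h3 := hT.1.1 i c' _ h1 hend h1.2.2
    simp only at h2
    rcases val _ hend with h | h
    · omega
    · exact h.2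
  by_cases hce : c = α.parts i
  · rw [hce]; exact hTend
  rw [hG, tableau_plain α a b X i c hic (fun h => hce h.2.2)]
  rcases val c hic with h | h
  · exact h
  by_contra hni
  have hcnt := hc i (G (i, α.parts i))
  have hle : (Finset.univ.filter fun k => (t.pos ((1 : Equiv.Perm (Fin n)) k)).1 = i ∧
      G (t.pos k) = G (i, α.parts i)).card ≤ 1 := by
    rw [Finset.card_le_one]
    have aux : ∀ k, (t.pos k).1 = i ∧ G (t.pos k) = G (i, α.parts i) →
        t.pos k = (i, α.parts i) := by
      rintro k ⟨hk1, hk2⟩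
      by_cases hk : plain k
      · exfalso
        rw [hGplain k hk, hk1] at hk2
        apply hni
        rw [h.2, ← hk2]
      · have hk' := not_not.mp hk
        refine Prod.ext hk1 ?_
        rw [hk'.2.2, hk1]
    intro k hk l hl
    replace hk := (Finset.mem_filter.mp hk).2
    replace hl := (Finset.mem_filter.mp hl).2
    rw [Equiv.Perm.one_apply] at hk hl
    exact t.inj ((aux k hk).trans (aux l hl).symm)
  rw [hcnt] at hle
  unfold rowContent at hle
  rw [Finset.card_le_one] at hle
  apply hce
  apply hle
  · exact Finset.mem_filter.mpr ⟨Finset.mem_Icc.mpr ⟨hic.2.1, hic.2.2⟩, h.2⟩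
  · exact Finset.mem_filter.mpr ⟨Finset.mem_Icc.mpr ⟨hend.2.1, hend.2.2⟩, hTend⟩

lemma type_tabloid {α : Partition n} (t : Placement α) (c : ℕ → ℕ) (T : ℕ × ℕ → ℕ)
    (hT : IsTypeOf α c T) :
    ∀ i, (Finset.univ.filter fun k => T (t.pos k) = i).card = c i := by
  intro i
  rw [← hT i]
  apply Finset.card_bij (fun k _ => t.pos k)
  · intro k hk
    simp only [Finset.mem_filter, Finset.mem_univ, true_and] at hk
    exact Finset.mem_filter.mpr ⟨(mem_cellFinset α _).mpr (t.mem k), hk⟩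
  · intro k _ l _ h
    exact t.inj h
  · intro d hd
    rw [Finset.mem_filter, mem_cellFinset] at hd
    obtain ⟨k, hk⟩ := t.surj d hd.1
    exact ⟨k, by simp [hk, hd.2], hk⟩

open Classical in
lemma coef_tableau (R : Type*) [CommRing R] {α β : Partition n} {a b : ℕ}
    (hs : OneBoxShift α β a b) (X : Finset ℕ)
    (hX : IsSSSet α a b X) (t : Placement α) (T : ℕ × ℕ → ℕ) (hT : T ∈ sstFinset α β) :
    coefAt R β.parts (fun k => tableauOfSet α a b X (t.pos k))
      (theta R α β.parts T (polytabloid R t)) = if T = tableauOfSet α a b X then 1 else 0 := by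
  rw [coefAt_theta R β.parts t T _ (type_tabloid t _ _ (tableau_type hs X hX))]
  have hT' : T ∈ SSTSet α β.parts := (Set.Finite.mem_toFinset _).mp hT
  have hu := content_unique hs X hX t T hT'
  split_ifs with h
  · rw [Finset.sum_eq_single 1]
    · rw [if_pos]
      · simp
      · rw [h]; exact content_id t _
    · intro π hπ hne
      exact if_neg fun hc => hne (hu π hπ hc).1
    · intro h1
      exact absurd (by simp [colStab]) h1
  · exact Finset.sum_eq_zero fun π hπ => if_neg fun hc => h (hu π hπ hc).2

/-- Removing a non-removable row from a semistandard set changes the sign of the coefficient. -/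
lemma coef_step (F : Type*) [Field F] {α β : Partition n} (a b : ℕ) (hs : OneBoxShift α β a b)
    (θ : ↥(Specht F α) →ₗ[F] PermMod F n β.parts)
    (hθ : θ ∈ SpechtHom F α β.parts (Specht F β))
    (Λ : (ℕ × ℕ → ℕ) → F)
    (hΛ : θ = ∑ T ∈ sstFinset α β, Λ T • thetaHat F α β.parts T)
    (X : Finset ℕ) (hX : IsSSSet α a b X) (u : ℕ) (hu : u ∈ X)
    (huR : α.parts (u + 1) = α.parts u) (hXu : IsSSSet α a b (X.erase u)) :
    Λ (tableauOfSet α a b X) + Λ (tableauOfSet α a b (X.erase u)) = 0 := by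
  classical
  obtain ⟨t⟩ := exists_placement α
  have ha0 := hs.a_pos
  have hab := hs.a_lt_b
  have hX' : ∀ x ∈ X, x ≤ b - 1 := fun x hx => (hX.2.1 x hx).2
  have hX2' : ∀ x ∈ X.erase u, x ≤ b - 1 := fun x hx => hX' x (Finset.mem_of_mem_erase hx)
  have hau : a < u := by
    have h1 := (hX.2.1 u hu).1
    have h2 : a ≠ u := (Finset.mem_erase.mp hXu.1).1
    omega
  have hu1 : u + 1 ∈ X := hX.2.2 u hu huR
  have hu1b := hX' _ hu1
  let e : ↥(Specht F α) := ⟨polytabloid F t, Submodule.subset_span ⟨t, rfl⟩⟩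
  have hcoef : ∀ g, coefAt F β.parts g (θ e) =
      ∑ T ∈ sstFinset α β, Λ T * coefAt F β.parts g (theta F α β.parts T (polytabloid F t)) := by
    intro g
    rw [hΛ, LinearMap.sum_apply, map_sum]
    refine Finset.sum_congr rfl fun T _ => ?_
    rw [LinearMap.smul_apply, map_smul, smul_eq_mul]
    rfl
  have hval : ∀ Y, IsSSSet α a b Y →
      coefAt F β.parts (fun k => tableauOfSet α a b Y (t.pos k)) (θ e) =
        Λ (tableauOfSet α a b Y) := by
    intro Y hY
    rw [hcoef, Finset.sum_eq_single (tableauOfSet α a b Y)]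
    · rw [coef_tableau F hs Y hY t _ (tableau_mem hs Y hY), if_pos rfl, mul_one]
    · intro T hT hne
      rw [coef_tableau F hs Y hY t T hT, if_neg hne, mul_zero]
    · intro h
      exact absurd (tableau_mem hs Y hY) h
  have hzero : ∀ (g : Fin n → ℕ) (k1 k2 : Fin n), k1 ≠ k2 → (t.pos k1).2 = (t.pos k2).2 →
      g k1 = g k2 → coefAt F β.parts g (θ e) = 0 := by
    intro g k1 k2 h1 h2 h3
    by_cases hg : ∀ i, (Finset.univ.filter fun k => g k = i).card = β.parts i
    · rw [hcoef]
      refine Finset.sum_eq_zero fun T _ => ?_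
      rw [coefAt_theta F β.parts t T g hg, content_sum_zero F t T g k1 k2 h1 h2 h3, mul_zero]
    · unfold coefAt
      rw [dif_neg hg]
      rfl
  -- the predecessor of `u` in `X`
  obtain ⟨v, hvX, hvu, hvmax⟩ : ∃ v, v ∈ X ∧ v < u ∧ ∀ x ∈ X, x < u → x ≤ v := by
    have hne : (X.filter (· < u)).Nonempty := ⟨a, Finset.mem_filter.mpr ⟨hX.1, hau⟩⟩
    refine ⟨(X.filter (· < u)).max' hne, ?_, ?_, ?_⟩
    · exact (Finset.mem_filter.mp (Finset.max'_mem _ hne)).1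
    · exact (Finset.mem_filter.mp (Finset.max'_mem _ hne)).2
    · intro x hx hxu
      exact Finset.le_max' _ _ (Finset.mem_filter.mpr ⟨hx, hxu⟩)
  have hv1 := hX.2.1 v hvX
  have hatu : hatOfSet X b u = u + 1 := by
    unfold hatOfSet
    rw [if_pos hu]
    exact nextIn_eq X b u (u + 1) (by omega) hX' (Or.inl hu1) (by omega) (fun x _ hx => by omega)
  have hatv : hatOfSet X b v = u := by
    unfold hatOfSet
    rw [if_pos hvX]
    refine nextIn_eq X b v u (by omega) hX' (Or.inl hu) hvu (fun x hx hvx => ?_)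
    by_contra h
    have := hvmax x hx (by omega)
    omega
  have hatu2 : hatOfSet (X.erase u) b u = u := by
    unfold hatOfSet
    rw [if_neg (by simp)]
  have hatv2 : hatOfSet (X.erase u) b v = u + 1 := by
    unfold hatOfSet
    rw [if_pos (Finset.mem_erase.mpr ⟨by omega, hvX⟩)]
    refine nextIn_eq _ b v (u + 1) (by omega) hX2'
      (Or.inl (Finset.mem_erase.mpr ⟨by omega, hu1⟩)) (by omega) (fun x hx hvx => ?_)
    rw [Finset.mem_erase] at hx
    by_contra h
    have := hvmax x hx.2 (by omega)
    omega
  have hato : ∀ w, w < b → w ≠ u → w ≠ v → hatOfSet (X.erase u) b w = hatOfSet X b w := by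
    intro w hwb hwu hwv
    by_cases hw : w ∈ X
    · have hne : hatOfSet X b w ≠ u := by
        rw [← hatv]
        exact fun h => hwv (hatOfSet_inj X b w v hwb (by omega) hX' h)
      unfold hatOfSet at hne ⊢
      rw [if_pos hw] at hne ⊢
      rw [if_pos (Finset.mem_erase.mpr ⟨hwu, hw⟩)]
      obtain ⟨s1, s2, s3, s4⟩ := nextIn_spec X b w hwb hX'
      refine nextIn_eq _ b w _ hwb hX2' ?_ s2
        (fun x hx hwx => s4 x (Finset.mem_of_mem_erase hx) hwx)
      rcases s1 with h | h
      · exact Or.inl (Finset.mem_erase.mpr ⟨hne, h⟩)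
      · exact Or.inr h
    · unfold hatOfSet
      rw [if_neg hw, if_neg (fun h => hw (Finset.mem_of_mem_erase h))]
  have hcu := end_mem hs u hau.le (by omega)
  have hcv := end_mem hs v hv1.1 hv1.2
  obtain ⟨ku, hku⟩ := t.surj _ hcu
  obtain ⟨kv, hkv⟩ := t.surj _ hcv
  have hkuv : ku ≠ kv := by
    intro h
    rw [h, hkv] at hku
    have := congrArg Prod.fst hku
    simp only at this
    omega
  let g : Fin n → ℕ := fun k => tableauOfSet α a b X (t.pos k)
  let h : Fin n → ℕ := Function.update g ku u
  have hhku : h ku = u := Function.update_self _ _ _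
  have hho : ∀ k, k ≠ ku → h k = tableauOfSet α a b X (t.pos k) := fun k hk =>
    Function.update_of_ne hk _ _
  have hhkv : h kv = u := by
    rw [hho kv hkuv.symm, hkv, tableau_end α a b X v _ hcv ⟨hv1.1, hv1.2, rfl⟩, hatv]
  have hker := specht_kernel F β (θ e) (hθ.1 e) u (by omega) h
  rw [Finset.sum_eq_add ku kv hkuv] at hker
  · have e1 : Function.update h ku (u + 1) = fun k => tableauOfSet α a b X (t.pos k) := by
      funext k
      by_cases hk : k = ku
      · subst hk
        rw [Function.update_self, hku,
          tableau_end α a b X u _ hcu ⟨hau.le, by omega, rfl⟩, hatu]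
      · rw [Function.update_of_ne hk, hho k hk]
    have e2 : Function.update h kv (u + 1) =
        fun k => tableauOfSet α a b (X.erase u) (t.pos k) := by
      funext k
      by_cases hk : k = kv
      · subst hk
        rw [Function.update_self, hkv, tableau_end α a b _ v _ hcv ⟨hv1.1, hv1.2, rfl⟩, hatv2]
      · rw [Function.update_of_ne hk]
        by_cases hk2 : k = ku
        · subst hk2
          rw [hhku, hku, tableau_end α a b _ u _ hcu ⟨hau.le, by omega, rfl⟩, hatu2]
        · rw [hho k hk2]
          have hmem : ((t.pos k).1, (t.pos k).2) ∈ α.cells := t.mem k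
          change tableauOfSet α a b X ((t.pos k).1, (t.pos k).2) =
            tableauOfSet α a b (X.erase u) ((t.pos k).1, (t.pos k).2)
          by_cases hp : a ≤ (t.pos k).1 ∧ (t.pos k).1 ≤ b - 1 ∧
              (t.pos k).2 = α.parts (t.pos k).1
          · rw [tableau_end α a b _ _ _ hmem hp, tableau_end α a b _ _ _ hmem hp, hato]
            · omega
            · intro h1
              apply hk2
              apply t.inj
              rw [hku]
              exact Prod.ext h1 (by rw [hp.2.2, h1])
            · intro h1
              apply hk
              apply t.inj
              rw [hkv]
              exact Prod.ext h1 (by rw [hp.2.2, h1])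
          · rw [tableau_plain α a b _ _ _ hmem hp, tableau_plain α a b _ _ _ hmem hp]
    rw [e1, e2, hval X hX, hval _ hXu] at hker
    exact hker
  · rintro k hk ⟨hk1, hk2⟩
    simp only [Finset.mem_filter, Finset.mem_univ, true_and] at hk
    have hk0 := hk
    rw [hho k hk1] at hk
    have hmem : ((t.pos k).1, (t.pos k).2) ∈ α.cells := t.mem k
    change tableauOfSet α a b X ((t.pos k).1, (t.pos k).2) = u at hk
    by_cases hp : a ≤ (t.pos k).1 ∧ (t.pos k).1 ≤ b - 1 ∧ (t.pos k).2 = α.parts (t.pos k).1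
    · exfalso
      rw [tableau_end α a b _ _ _ hmem hp, ← hatv] at hk
      have h1 := hatOfSet_inj X b _ v (by omega) (by omega) hX' hk
      apply hk2
      apply t.inj
      rw [hkv]
      exact Prod.ext h1 (by rw [hp.2.2, h1])
    · rw [tableau_plain α a b _ _ _ hmem hp] at hk
      have hne : (t.pos k).2 ≠ α.parts u := by
        intro h1
        apply hp
        rw [hk]
        exact ⟨hau.le, by omega, h1⟩
      have hcell : (u + 1, (t.pos k).2) ∈ α.cells := by
        refine ⟨Nat.succ_pos u, hmem.2.1, ?_⟩
        simp only
        rw [huR]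
        have h1 := hmem.2.2
        simp only at h1
        rwa [hk] at h1
      obtain ⟨k2, hk2e⟩ := t.surj _ hcell
      have hk2u : (t.pos k2).1 = u + 1 := by rw [hk2e]
      have hkk2 : k ≠ k2 := by
        intro h1
        rw [← h1] at hk2u
        omega
      have hk2ku : k2 ≠ ku := by
        intro h1
        rw [h1, hku] at hk2u
        simp at hk2u
      apply hzero _ k k2 hkk2 (by rw [hk2e])
      rw [Function.update_self, Function.update_of_ne hkk2.symm, hho k2 hk2ku, hk2e,
        tableau_plain α a b X _ _ hcell]
      rintro ⟨_, _, h3⟩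
      exact hne (h3.trans huR)
  · intro h1
    exact (h1 (Finset.mem_filter.mpr ⟨Finset.mem_univ _, hhku⟩)).elim
  · intro h1
    exact (h1 (Finset.mem_filter.mpr ⟨Finset.mem_univ _, hhkv⟩)).elim

lemma coef_all (F : Type*) [Field F] {α β : Partition n} (a b : ℕ) (hs : OneBoxShift α β a b)
    (θ : ↥(Specht F α) →ₗ[F] PermMod F n β.parts)
    (hθ : θ ∈ SpechtHom F α β.parts (Specht F β))
    (Λ : (ℕ × ℕ → ℕ) → F)
    (hΛ : θ = ∑ T ∈ sstFinset α β, Λ T • thetaHat F α β.parts T) (m : ℕ) :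
    ∀ (X : Finset ℕ), X.card = m → IsSSSet α a b X →
    (-1 : F) ^ X.card * Λ (tableauOfSet α a b X) =
      (-1 : F) ^ (X ∩ Rset α a b).card * Λ (tableauOfSet α a b (X ∩ Rset α a b)) := by
  induction m with
  | zero =>
    intro X hm hX
    rw [Finset.card_eq_zero] at hm
    have := hX.1
    rw [hm] at this
    simp at this
  | succ m ih =>
    intro X hm hX
    by_cases hne : (X \ Rset α a b).Nonempty
    · have hmem := Finset.min'_mem _ hne
      set u := (X \ Rset α a b).min' hne with hu
      rw [Finset.mem_sdiff] at hmem
      obtain ⟨huX, huR⟩ := hmem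
      have hub := hX.2.1 u huX
      have ha0 := hs.a_pos
      have hab := hs.a_lt_b
      have hpu : α.parts (u + 1) = α.parts u := by
        have h1 := α.antitone (by omega : 0 < u) (Nat.le_succ u)
        have h2 : ¬ α.parts (u + 1) < α.parts u := fun h =>
          huR (Finset.mem_filter.mpr ⟨Finset.mem_Icc.mpr hub, h⟩)
        simp only [Nat.succ_eq_add_one] at h1
        omega
      have hau : a ≠ u := by
        intro h
        have := hs.rem
        rw [h] at this
        omega
      have hXu : IsSSSet α a b (X.erase u) := by
        refine ⟨Finset.mem_erase.mpr ⟨hau, hX.1⟩,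
          fun x hx => hX.2.1 x (Finset.mem_of_mem_erase hx), fun x hx hxx => ?_⟩
        rw [Finset.mem_erase] at hx ⊢
        refine ⟨fun h => ?_, hX.2.2 x hx.2 hxx⟩
        have h1 : x ∈ X \ Rset α a b := by
          rw [Finset.mem_sdiff]
          refine ⟨hx.2, fun h2 => ?_⟩
          have := (Finset.mem_filter.mp h2).2
          omega
        have h2 := Finset.min'_le _ _ h1
        rw [← hu] at h2
        omega
      have hcard : (X.erase u).card = m := by
        rw [Finset.card_erase_of_mem huX, hm]; rfl
      have h1 := ih (X.erase u) hcard hXu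
      have h2 : X.erase u ∩ Rset α a b = X ∩ Rset α a b := by
        ext x
        simp only [Finset.mem_inter, Finset.mem_erase]
        constructor
        · rintro ⟨⟨_, h3⟩, h4⟩
          exact ⟨h3, h4⟩
        · rintro ⟨h3, h4⟩
          exact ⟨⟨fun h => huR (h ▸ h4), h3⟩, h4⟩
      have h3 := coef_step F a b hs θ hθ Λ hΛ X hX u huX hpu hXu
      rw [h2, hcard] at h1
      rw [← h1, hm, pow_succ, eq_neg_of_add_eq_zero_left h3]
      ring
    · rw [Finset.not_nonempty_iff_eq_empty, Finset.sdiff_eq_empty_iff_subset] at hne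
      rw [Finset.inter_eq_left.mpr hne]

/-- Let `F` be a field of characteristic `p > 2`, `β` a one-box-shift of
`α` (from row `a` to row `b`, `a < b`), and let `θ̂ : S^α → S^β` be any
`FΣ_n`-homomorphism, written `θ̂ = Σ_T Λ_T θ̂_T` over semistandard `α`-tableaux `T` of
type `β`.  Then for every semistandard `α`-set `{T}` of type `β`,
`(-1)^{|{T}|} Λ_{{T}} = (-1)^{|{T} ∩ {R}|} Λ_{{T} ∩ {R}}`, where `{R}` is the removable
set. -/
theorem stmt13 (F : Type*) [Field F] (p : ℕ) [CharP F p] (hp : 2 < p)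
    {n : ℕ} (α β : Partition n) (a b : ℕ) (hshift : OneBoxShift α β a b)
    (θ : ↥(Specht F α) →ₗ[F] PermMod F n β.parts)
    (hθ : θ ∈ SpechtHom F α β.parts (Specht F β))
    (Λ : (ℕ × ℕ → ℕ) → F)
    (hΛ : θ = ∑ T ∈ sstFinset α β, Λ T • thetaHat F α β.parts T)
    (X : Finset ℕ) (hX : IsSSSet α a b X) :
    (-1 : F) ^ X.card * Λ (tableauOfSet α a b X) =
      (-1 : F) ^ (X ∩ Rset α a b).card * Λ (tableauOfSet α a b (X ∩ Rset α a b)) := by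
  exact coef_all F a b hshift θ hθ Λ hΛ X.card X rfl hX

end CarterPayne
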